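/- arXiv:2508.21755 — 6 statements merged into one kernel-verified Lean document; each statement's English description precedes it below -/
import Mathlib

section
/- Let f ≥ 1, let n : Fin f → ℤ with n j ≥ 0 for all j, let B : ℤ, and let x : Fin f → ℝ satisfy 0 ≤ x j ≤ n j for all j and ∑ j, x j = B. Then there exists an integer allocation y : Fin f → ℤ with ∑ j, y j = B, 0 ≤ y j ≤ n j for all j, |(y j : ℝ) − x j| ≤ 1 for every j, and consequently ∑ j, |(y j : ℝ) − x j| ≤ f. -/
/-- An integer between the sums of `a ≤ b` is the sum of an integer function between `a` and `b`. -/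
theorem Finset.exists_int_sum_eq_of_le_of_le {ι : Type*} (s : Finset ι) {a b : ι → ℤ}
    (hab : ∀ i, a i ≤ b i) {B : ℤ} (ha : ∑ i ∈ s, a i ≤ B) (hb : B ≤ ∑ i ∈ s, b i) :
    ∃ y : ι → ℤ, ∑ i ∈ s, y i = B ∧ ∀ i, a i ≤ y i ∧ y i ≤ b i := by
  classical
  induction s using Finset.induction_on generalizing B with
  | empty =>
    rw [Finset.sum_empty] at ha hb
    exact ⟨a, by rw [Finset.sum_empty]; omega, fun i => ⟨le_rfl, hab i⟩⟩
  | insert i s hi ih =>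
    rw [Finset.sum_insert hi] at ha hb
    have hs : ∑ j ∈ s, a j ≤ ∑ j ∈ s, b j := Finset.sum_le_sum fun j _ => hab j
    have hi' := hab i
    obtain ⟨c, hac, hcb, hc₁, hc₂⟩ : ∃ c, a i ≤ c ∧ c ≤ b i ∧
        ∑ j ∈ s, a j ≤ B - c ∧ B - c ≤ ∑ j ∈ s, b j :=
      ⟨max (a i) (B - ∑ j ∈ s, b j), by omega, by omega, by omega, by omega⟩
    obtain ⟨y, hy, hyab⟩ := ih hc₁ hc₂
    refine ⟨Function.update y i c, ?_, fun j => ?_⟩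
    · rw [Finset.sum_insert hi, Finset.sum_update_of_notMem hi, Function.update_self, hy]
      ring
    · rcases eq_or_ne j i with rfl | hj
      · rw [Function.update_self]
        exact ⟨hac, hcb⟩
      · rw [Function.update_of_ne hj]
        exact hyab j

/-- Lemma 1 (Rounding Error Bound): any continuous truncated water-filling
allocation `x` with integer budget `B` and capacities `n` can be rounded to an
integer allocation `y` with the same budget, respecting the capacities, with
componentwise deviation at most `1` and total deviation at most `f`. -/
theorem rounding_error_bound (f : ℕ) (hf : 1 ≤ f) (n : Fin f → ℤ)
    (hn : ∀ j, 0 ≤ n j) (B : ℤ) (x : Fin f → ℝ)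
    (hx0 : ∀ j, 0 ≤ x j) (hxn : ∀ j, x j ≤ (n j : ℝ))
    (hsum : ∑ j, x j = (B : ℝ)) :
    ∃ y : Fin f → ℤ, (∑ j, y j = B) ∧ (∀ j, 0 ≤ y j) ∧ (∀ j, y j ≤ n j) ∧
      (∀ j, |(y j : ℝ) - x j| ≤ 1) ∧ (∑ j, |(y j : ℝ) - x j|) ≤ (f : ℝ) := by
  obtain ⟨y, hyB, hy⟩ := Finset.univ.exists_int_sum_eq_of_le_of_le (B := B)
    (fun j => Int.floor_le_ceil (x j))
    (by
      have h := Finset.sum_le_sum fun j (_ : j ∈ Finset.univ) => Int.floor_le (x j)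
      rw [hsum] at h
      exact_mod_cast h)
    (by
      have h := Finset.sum_le_sum fun j (_ : j ∈ Finset.univ) => Int.le_ceil (x j)
      rw [hsum] at h
      exact_mod_cast h)
  have hdev : ∀ j, |(y j : ℝ) - x j| ≤ 1 := fun j => by
    have h₁ : (⌊x j⌋ : ℝ) ≤ y j := by exact_mod_cast (hy j).1
    have h₂ : (y j : ℝ) ≤ ⌈x j⌉ := by exact_mod_cast (hy j).2
    rw [abs_le]
    constructor <;> linarith [Int.sub_one_lt_floor (x j), Int.ceil_lt_add_one (x j)]
  refine ⟨y, hyB, fun j => (Int.floor_nonneg.2 (hx0 j)).trans (hy j).1,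
    fun j => (hy j).2.trans (Int.ceil_le.2 (hxn j)), hdev, ?_⟩
  simpa using Finset.sum_le_card_nsmul Finset.univ _ 1 fun j _ => hdev j
end

section
/- Let f ≥ 1, let x : Fin f → ℝ, and let B : ℤ with ∑ j, x j = B. Then there exists y : Fin f → ℤ with ∑ j, y j = B and ⌊x j⌋ ≤ y j ≤ ⌈x j⌉ for every j. -/
/-- Integer selections from the intervals `[l i, u i]` attain every total between
`∑ i ∈ s, l i` and `∑ i ∈ s, u i`. -/
theorem exists_sum_eq_of_sum_le_of_le_sum {ι : Type*} (s : Finset ι) (l u : ι → ℤ)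
    (hlu : ∀ i, l i ≤ u i) (B : ℤ) (hl : ∑ i ∈ s, l i ≤ B) (hu : B ≤ ∑ i ∈ s, u i) :
    ∃ y : ι → ℤ, ∑ i ∈ s, y i = B ∧ ∀ i, l i ≤ y i ∧ y i ≤ u i := by
  classical
  induction s using Finset.induction_on generalizing B with
  | empty =>
    simp only [Finset.sum_empty] at hl hu
    exact ⟨l, by simpa using le_antisymm hl hu, fun i => ⟨le_rfl, hlu i⟩⟩
  | insert a s ha ih =>
    rw [Finset.sum_insert ha] at hl hu
    have hs : ∑ i ∈ s, l i ≤ ∑ i ∈ s, u i := Finset.sum_le_sum fun i _ => hlu i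
    have hla := hlu a
    obtain ⟨c, hlc, hcu, hc₁, hc₂⟩ : ∃ c, l a ≤ c ∧ c ≤ u a ∧
        ∑ i ∈ s, l i ≤ B - c ∧ B - c ≤ ∑ i ∈ s, u i :=
      ⟨max (l a) (B - ∑ i ∈ s, u i), by omega, by omega, by omega, by omega⟩
    obtain ⟨y, hy, hby⟩ := ih (B - c) hc₁ hc₂
    refine ⟨Function.update y a c, ?_, fun i => ?_⟩
    · rw [Finset.sum_insert ha, Finset.sum_update_of_notMem ha, hy, Function.update_self]
      ring
    · rcases eq_or_ne i a with rfl | hi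
      · simpa using ⟨hlc, hcu⟩
      · simpa [hi] using hby i

/-- Rounding lemma: any real-valued allocation whose components sum to an
integer budget `B` can be rounded componentwise (each component to its floor or
its ceiling) so that the rounded integer allocation still sums exactly to `B`. -/
theorem exists_integer_rounding (f : ℕ) (hf : 1 ≤ f) (x : Fin f → ℝ) (B : ℤ)
    (hsum : ∑ j, x j = (B : ℝ)) :
    ∃ y : Fin f → ℤ, (∑ j, y j = B) ∧ ∀ j, ⌊x j⌋ ≤ y j ∧ y j ≤ ⌈x j⌉ := by
  refine exists_sum_eq_of_sum_le_of_le_sum Finset.univ (fun j => ⌊x j⌋) (fun j => ⌈x j⌉)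
    (fun j => Int.floor_le_ceil (x j)) B ?_ ?_
  · have h : ∑ j, (⌊x j⌋ : ℝ) ≤ B := hsum ▸ Finset.sum_le_sum fun j _ => Int.floor_le (x j)
    exact_mod_cast h
  · have h : (B : ℝ) ≤ ∑ j, (⌈x j⌉ : ℝ) := hsum ▸ Finset.sum_le_sum fun j _ => Int.le_ceil (x j)
    exact_mod_cast h
end

section
/- Let f ≥ 1, let n : Fin f → ℝ with n j ≥ 0 for all j, and let B : ℝ with 0 ≤ B ≤ ∑ j, n j. Then there exists a water level θ ≥ 0 such that ∑ j, min θ (n j) = B, and the resulting allocation x j = min θ (n j) satisfies 0 ≤ x j ≤ n j for every j and ∑ j, x j = B. -/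
/-- Existence and feasibility of the truncated water-filling allocation: for
nonnegative capacities `n` and a budget `0 ≤ B ≤ ∑ j, n j`, there is a water
level `θ ≥ 0` with `∑ j, min θ (n j) = B`, and the allocation
`x j = min θ (n j)` is feasible: `0 ≤ x j ≤ n j` and `∑ j, x j = B`. -/
theorem waterfilling_exists (f : ℕ) (hf : 1 ≤ f) (n : Fin f → ℝ)
    (hn : ∀ j, 0 ≤ n j) (B : ℝ) (hB0 : 0 ≤ B) (hB1 : B ≤ ∑ j, n j) :
    ∃ θ : ℝ, 0 ≤ θ ∧ (∑ j, min θ (n j)) = B ∧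
      (∀ j, 0 ≤ min θ (n j) ∧ min θ (n j) ≤ n j) ∧
      (∑ j, min θ (n j)) = B := by
  have hcont : Continuous fun θ : ℝ => ∑ j, min θ (n j) := by fun_prop
  have hzero : ∑ j, min 0 (n j) = 0 :=
    Finset.sum_eq_zero fun j _ => min_eq_left (hn j)
  have htotal : ∑ j, min (∑ i, n i) (n j) = ∑ j, n j :=
    Finset.sum_congr rfl fun j hj =>
      min_eq_right (Finset.single_le_sum (fun i _ => hn i) hj)
  obtain ⟨θ, ⟨hθ, -⟩, hsum⟩ :=
    intermediate_value_Icc (hB0.trans hB1) hcont.continuousOn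
      (show B ∈ Set.Icc (∑ j, min 0 (n j)) (∑ j, min (∑ i, n i) (n j)) by
        rw [hzero, htotal]
        exact ⟨hB0, hB1⟩)
  exact ⟨θ, hθ, hsum, fun j => ⟨le_min hθ (hn j), min_le_right _ _⟩, hsum⟩
end

section
/- Let f ≥ 1, let n : Fin f → ℝ with n j ≥ 0 for all j, and let B : ℝ with 0 ≤ B < ∑ j, n j. If θ ≥ 0 and θ' ≥ 0 both satisfy ∑ j, min θ (n j) = B and ∑ j, min θ' (n j) = B, then θ = θ'. -/
/-- Below saturation, the total truncated allocation is strictly increasing in the level. -/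
theorem sum_min_lt_sum_min_of_lt {ι : Type*} {s : Finset ι} {n : ι → ℝ} {a b : ℝ}
    (hab : a < b) (ha : ∑ j ∈ s, min a (n j) < ∑ j ∈ s, n j) :
    ∑ j ∈ s, min a (n j) < ∑ j ∈ s, min b (n j) := by
  obtain ⟨j, hj, hlt⟩ := Finset.exists_lt_of_sum_lt ha
  have haj : a < n j := by simpa using hlt
  refine Finset.sum_lt_sum (fun i _ => min_le_min_right _ hab.le) ⟨j, hj, ?_⟩
  rw [min_eq_left haj.le]
  exact lt_min hab haj

/-- Uniqueness of the water level: if the budget `B` satisfies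
`0 ≤ B < ∑ j, n j`, then two nonnegative water levels achieving the same budget
`∑ j, min θ (n j) = B` must coincide. -/
theorem waterfilling_water_level_unique (f : ℕ) (hf : 1 ≤ f) (n : Fin f → ℝ)
    (hn : ∀ j, 0 ≤ n j) (B : ℝ) (hB0 : 0 ≤ B) (hB1 : B < ∑ j, n j)
    (θ θ' : ℝ) (hθ : 0 ≤ θ) (hθ' : 0 ≤ θ')
    (h : (∑ j, min θ (n j)) = B) (h' : (∑ j, min θ' (n j)) = B) :
    θ = θ' := by
  rcases lt_trichotomy θ θ' with hlt | heq | hlt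
  · exact absurd (h.trans h'.symm) (sum_min_lt_sum_min_of_lt hlt (h.trans_lt hB1)).ne
  · exact heq
  · exact absurd (h'.trans h.symm) (sum_min_lt_sum_min_of_lt hlt (h'.trans_lt hB1)).ne
end

section
/- Let f ≥ 1, let n : Fin f → ℝ with n j ≥ 0 for all j, let T ≥ 1, and let θ : Fin T → ℝ with θ t ≥ 0 for all t. Define remaining capacities recursively by r 0 j = n j and r (t+1) j = r t j − min (θ t) (r t j), and per-round allocations a t j = min (θ t) (r t j). Then for every j, ∑ t, a t j = min (∑ t, θ t) (n j). In particular, if each round's water level is chosen so that ∑ j, a t j = B for every t, then the cumulative allocation after T rounds equals the single-shot truncated water-filling allocation min(θ_total, n_j) with water level θ_total = ∑_t θ_t, which satisfies ∑ j, min θ_total (n j) = T·B. -/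
theorem min_add_min_sub_min {s x c : ℝ} (hx : 0 ≤ x) :
    min s c + min x (c - min s c) = min (s + x) c := by
  rcases le_total s c with h | h
  · rw [min_eq_left h, ← min_add_add_left, add_sub_cancel]
  · rw [min_eq_right h, sub_self, min_eq_right hx, add_zero,
      min_eq_right (h.trans (le_add_of_nonneg_right hx))]

theorem sum_min_remaining_capacity (T : ℕ) (θ : Fin T → ℝ) (hθ : ∀ t, 0 ≤ θ t)
    (c : ℕ → ℝ) (hc : 0 ≤ c 0)
    (hrec : ∀ t : Fin T, c ((t : ℕ) + 1) = c (t : ℕ) - min (θ t) (c (t : ℕ))) :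
    ∑ t : Fin T, min (θ t) (c (t : ℕ)) = min (∑ t, θ t) (c 0) ∧
      c T = c 0 - min (∑ t, θ t) (c 0) := by
  induction T with
  | zero => simp [hc]
  | succ T ih =>
    obtain ⟨hsum, hlast⟩ := ih (fun t => θ t.castSucc) (fun t => hθ _) fun t => by
      simpa using hrec t.castSucc
    have hstep := hrec (Fin.last T)
    have key := min_add_min_sub_min (s := ∑ t : Fin T, θ t.castSucc) (c := c 0)
      (hθ (Fin.last T))
    simp only [Fin.val_last] at hstep
    simp only [Fin.sum_univ_castSucc, Fin.val_castSucc, Fin.val_last]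
    rw [hstep, hsum, hlast, key, sub_sub, key]
    exact ⟨rfl, rfl⟩


/-- Multi-round semantic communication: with remaining capacities
`r 0 j = n j`, `r (t+1) j = r t j - min (θ t) (r t j)` and per-round
allocations `a t j = min (θ t) (r t j)`, the cumulative myopic allocation
equals the single-shot truncated water-filling allocation with water level
`∑ t, θ t`; in particular, if each round meets the per-round budget `B`, then
the cumulative allocation sums to `T·B`. -/
theorem multiround_waterfilling (f : ℕ) (hf : 1 ≤ f) (n : Fin f → ℝ)
    (hn : ∀ j, 0 ≤ n j) (T : ℕ) (hT : 1 ≤ T) (θ : Fin T → ℝ)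
    (hθ : ∀ t, 0 ≤ θ t) (B : ℝ)
    (r : ℕ → Fin f → ℝ) (hr0 : ∀ j, r 0 j = n j)
    (hrec : ∀ t : Fin T, ∀ j, r ((t : ℕ) + 1) j =
      r (t : ℕ) j - min (θ t) (r (t : ℕ) j))
    (a : Fin T → Fin f → ℝ)
    (ha : ∀ t j, a t j = min (θ t) (r (t : ℕ) j)) :
    (∀ j, ∑ t, a t j = min (∑ t, θ t) (n j)) ∧
      ((∀ t, ∑ j, a t j = B) →
        ∑ j, min (∑ t, θ t) (n j) = (T : ℝ) * B) := by
  have hcum : ∀ j, ∑ t, a t j = min (∑ t, θ t) (n j) := fun j => by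
    simp only [ha, ← hr0]
    exact (sum_min_remaining_capacity T θ hθ (fun t => r t j)
      (by simpa only [hr0] using hn j) fun t => hrec t j).1
  refine ⟨hcum, fun hB => ?_⟩
  simp only [← hcum]
  rw [Finset.sum_comm]
  simp [hB]
end

section
/- Let f ≥ 1, let n : Fin f → ℝ with n j ≥ 0, and let B : ℝ with 0 ≤ B ≤ ∑ j, n j. Let θ ≥ 0 satisfy ∑ j, min θ (n j) = B, and set x* j = min θ (n j). Let S = {x : Fin f → ℝ | (∀ j, 0 ≤ x j) ∧ ∑ j, x j = B} and D = {x ∈ S | ∀ j, x j ≤ n j}. If F : (Fin f → ℝ) → ℝ is concave on S and permutation invariant (F (x ∘ σ) = F x for every permutation σ of Fin f and every x), then x* maximizes F over D: for every x ∈ D, F x ≤ F x*. -/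
/-- Moving an amount `δ ≤ x i - x j` from the coordinate `i` to the coordinate `j` does not decrease
a concave function that takes the same value at `x` and at `x` with these coordinates swapped. -/
theorem ConcaveOn.le_of_transfer {ι : Type*} [DecidableEq ι] {S : Set (ι → ℝ)} {F : (ι → ℝ) → ℝ}
    (hF : ConcaveOn ℝ S F) {x : ι → ℝ} {i j : ι} {δ : ℝ} (hx : x ∈ S)
    (hxs : x ∘ Equiv.swap i j ∈ S) (hsymm : F (x ∘ Equiv.swap i j) = F x) (hij : x j < x i)
    (hδ : 0 ≤ δ) (hδ' : δ ≤ x i - x j) :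
    F x ≤ F (x + (Pi.single j δ - Pi.single i δ)) := by
  have hd : 0 < x i - x j := sub_pos.2 hij
  have hne : i ≠ j := by rintro rfl; exact lt_irrefl _ hij
  have ht : δ / (x i - x j) ≤ 1 := (div_le_one hd).2 hδ'
  have key := hF.2 hx hxs (sub_nonneg.2 ht) (div_nonneg hδ hd.le) (by ring)
  have hy : (1 - δ / (x i - x j)) • x + (δ / (x i - x j)) • (x ∘ Equiv.swap i j) =
      x + (Pi.single j δ - Pi.single i δ) := by
    have hmul : δ / (x i - x j) * (x i - x j) = δ := div_mul_cancel₀ _ hd.ne'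
    funext k
    by_cases hki : k = i
    · subst hki
      simp [hne]
      linarith
    · by_cases hkj : k = j
      · subst hkj
        simp [hki]
        linarith
      · simp [hki, hkj, Equiv.swap_apply_of_ne_of_ne hki hkj]
        ring
  rw [hy, hsymm, smul_eq_mul, smul_eq_mul] at key
  linarith

/-- If every coordinate where `x` exceeds `z` carries a maximal value of `z`, then `z` is at least as
good as `x` for every permutation-invariant function concave on the scaled simplex. -/
theorem ConcaveOn.le_of_forall_le_of_lt {ι : Type*} [Fintype ι] [DecidableEq ι] {B : ℝ}
    {F : (ι → ℝ) → ℝ}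
    (hF : ConcaveOn ℝ {x : ι → ℝ | (∀ j, 0 ≤ x j) ∧ ∑ j, x j = B} F)
    (hsymm : ∀ σ : Equiv.Perm ι, ∀ x : ι → ℝ, F (x ∘ σ) = F x) {x z : ι → ℝ}
    (hz : ∀ j, 0 ≤ z j) (hzB : ∑ j, z j = B) (hx : ∀ j, 0 ≤ x j) (hxB : ∑ j, x j = B)
    (hxz : ∀ i, z i < x i → ∀ j, z j ≤ z i) : F x ≤ F z := by
  induction hN : (Finset.univ.filter fun k => x k ≠ z k).card using Nat.strong_induction_on
    generalizing x with
  | _ N ih =>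
    by_cases hne : x = z
    · rw [hne]
    have hsum : ∑ k, x k = ∑ k, z k := hxB.trans hzB.symm
    obtain ⟨k, hk⟩ := Function.ne_iff.1 hne
    obtain ⟨i, hi⟩ : ∃ i, z i < x i := by
      by_contra! h
      exact hk ((Finset.sum_eq_sum_iff_of_le fun a _ => h a).1 hsum k (Finset.mem_univ k))
    obtain ⟨j, hj⟩ : ∃ j, x j < z j := by
      by_contra! h
      exact hk ((Finset.sum_eq_sum_iff_of_le fun a _ => h a).1 hsum.symm k (Finset.mem_univ k)).symm
    have hzij := hxz i hi j
    have hij : i ≠ j := by rintro rfl; exact lt_asymm hi hj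
    obtain ⟨δ, hδ⟩ : ∃ δ, δ = min (x i - z i) (z j - x j) := ⟨_, rfl⟩
    have hδ0 : 0 < δ := hδ ▸ lt_min (sub_pos.2 hi) (sub_pos.2 hj)
    have hδi : δ ≤ x i - z i := hδ ▸ min_le_left _ _
    have hδj : δ ≤ z j - x j := hδ ▸ min_le_right _ _
    obtain ⟨y, hy⟩ : ∃ y : ι → ℝ, y = x + (Pi.single j δ - Pi.single i δ) := ⟨_, rfl⟩
    have hyi : y i = x i - δ := by simp [hy, hij, sub_eq_add_neg]
    have hyj : y j = x j + δ := by simp [hy, hij.symm]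
    have hyk : ∀ k, k ≠ i → k ≠ j → y k = x k := fun k h h' => by simp [hy, h, h']
    have hxy : F x ≤ F y := by
      rw [hy]
      refine hF.le_of_transfer ⟨hx, hxB⟩ ⟨fun k => hx _, ?_⟩ (hsymm _ x) (by linarith) hδ0.le
        (by linarith)
      exact (Equiv.sum_comp (Equiv.swap i j) x).trans hxB
    refine hxy.trans (ih _ ?_ ?_ ?_ ?_ rfl)
    · rw [← hN]
      apply Finset.card_lt_card
      rw [Finset.ssubset_iff_of_subset]
      · rcases min_choice (x i - z i) (z j - x j) with h | h
        · exact ⟨i, by simp [hi.ne'], by simp [hyi, hδ, h]⟩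
        · exact ⟨j, by simp [hj.ne], by simp [hyj, hδ, h]⟩
      · intro k hk
        simp only [Finset.mem_filter, Finset.mem_univ, true_and] at hk ⊢
        by_cases hki : k = i
        · exact hki ▸ hi.ne'
        · by_cases hkj : k = j
          · exact hkj ▸ hj.ne
          · rwa [← hyk k hki hkj]
    · intro k
      by_cases hki : k = i
      · rw [hki, hyi]; linarith [hz i]
      · by_cases hkj : k = j
        · rw [hkj, hyj]; linarith [hx j]
        · rw [hyk k hki hkj]; exact hx k
    · simp [hy, Finset.sum_add_distrib, hxB]
    · intro k hk
      apply hxz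
      by_cases hki : k = i
      · rwa [hki]
      · by_cases hkj : k = j
        · rw [hkj, hyj] at hk; linarith
        · rwa [← hyk k hki hkj]

/-- Optimality of truncated water-filling under capacity constraints: the
point `x* j = min θ (n j)`, with water level `θ` satisfying
`∑ j, min θ (n j) = B`, maximizes any permutation-invariant objective that is
concave on the scaled simplex `S` over the capacity-constrained feasible set
`D = {x ∈ S | ∀ j, x j ≤ n j}`. -/
theorem waterfilling_maximizes_perm_invariant_concave (f : ℕ) (hf : 1 ≤ f)
    (n : Fin f → ℝ) (hn : ∀ j, 0 ≤ n j) (B : ℝ) (hB0 : 0 ≤ B)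
    (hB1 : B ≤ ∑ j, n j) (θ : ℝ) (hθ : 0 ≤ θ)
    (hθB : (∑ j, min θ (n j)) = B) (xstar : Fin f → ℝ)
    (hxstar : ∀ j, xstar j = min θ (n j))
    (S : Set (Fin f → ℝ))
    (hS : S = {x : Fin f → ℝ | (∀ j, 0 ≤ x j) ∧ ∑ j, x j = B})
    (D : Set (Fin f → ℝ)) (hD : D = {x ∈ S | ∀ j, x j ≤ n j})
    (F : (Fin f → ℝ) → ℝ) (hconc : ConcaveOn ℝ S F)
    (hsym : ∀ σ : Equiv.Perm (Fin f), ∀ x : Fin f → ℝ, F (x ∘ σ) = F x) :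
    ∀ x ∈ D, F x ≤ F xstar := by
  subst hS hD
  rintro x ⟨⟨hx0, hxB⟩, hxn⟩
  refine hconc.le_of_forall_le_of_lt hsym (fun j => ?_) ?_ hx0 hxB fun i hi j => ?_
  · rw [hxstar]; exact le_min hθ (hn j)
  · simp only [hxstar, hθB]
  · rw [hxstar] at hi
    have hθi : θ ≤ n i := by
      by_contra! h
      rw [min_eq_right h.le] at hi
      exact hi.not_ge (hxn i)
    rw [hxstar, hxstar, min_eq_left hθi]
    exact min_le_left _ _
end
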